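/- Let A ∈ SL(3, ℝ) generate an infinite cyclic group preserving a properly convex open subset Ω ⊂ ℝP² homeomorphic to a disc minus a boundary point, acting freely on Ω and preserving orientation, with ∂Ω strictly convex. Then all eigenvalues of A are real, and (after replacing A by -A if necessary) positive; hence A is conjugate over ℝ to an upper triangular matrix with positive diagonal entries. -/

import Mathlib

open Matrix

/-- The real projective plane, as the projectivization of ℝ³. -/
abbrev RP2 := Projectivization ℝ (Fin 3 → ℝ)

/-- The quotient topology on ℝP², induced from ℝ³ \ {0}. -/
instance : TopologicalSpace RP2 :=
  inferInstanceAs (TopologicalSpace (Quotient (projectivizationSetoid ℝ (Fin 3 → ℝ))))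

/-- A subset of ℝP² is properly convex: its intersection with every projective line
(the projectivization of a 2-dimensional subspace) is connected and omits at least two
points of the line. -/
def ProperlyConvex (Ω : Set RP2) : Prop :=
  ∀ W : Submodule ℝ (Fin 3 → ℝ), Module.finrank ℝ W = 2 →
    IsPreconnected {x : RP2 | x ∈ Ω ∧ x.submodule ≤ W} ∧
    ∃ p q : RP2, p.submodule ≤ W ∧ q.submodule ≤ W ∧ p ≠ q ∧ p ∉ Ω ∧ q ∉ Ω

/-- The boundary `∂Ω = Ω \ interior Ω` is strictly convex: it contains no line segment,
i.e. any connected subset of the boundary lying on a projective line is a single point. -/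
def StrictlyConvexBoundary (Ω : Set RP2) : Prop :=
  ∀ W : Submodule ℝ (Fin 3 → ℝ), Module.finrank ℝ W = 2 →
    ∀ S : Set RP2, S ⊆ (Ω \ interior Ω) ∩ {x : RP2 | x.submodule ≤ W} →
      IsPreconnected S → S.Subsingleton

/-- A closed disc with one point deleted from its boundary. -/
def discMinusPoint : Set (ℝ × ℝ) := {p | p.1 ^ 2 + p.2 ^ 2 ≤ 1 ∧ p ≠ (1, 0)}


theorem ch_recur (u : ℕ → ℝ) (τ δ : ℝ) (hd : τ ^ 2 < 4 * δ) (hu : ∀ n, 0 ≤ u n)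
    (hr : ∀ n, u (n + 2) = τ * u (n + 1) - δ * u n) : u 0 = 0 ∧ u 1 = 0 := by
  have hδ : 0 < δ := by nlinarith [sq_nonneg τ]
  by_cases hz : ∃ n, u (n + 1) = 0
  · obtain ⟨n, hn⟩ := hz
    have h1 : u n = 0 := by
      have := hr n
      rw [hn] at this
      have h2 := hu (n + 2)
      have h3 := hu n
      nlinarith
    clear hu
    induction n with
    | zero => exact ⟨h1, hn⟩
    | succ k ih =>
      apply ih h1
      have := hr k
      rw [hn, h1] at this
      have : δ * u k = 0 := by linarith
      exact (mul_eq_zero.mp this).resolve_left hδ.ne'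
  · exfalso
    push Not at hz
    have hpos : ∀ n, 0 < u (n + 1) := fun n => lt_of_le_of_ne (hu _) (Ne.symm (hz n))
    set r : ℕ → ℝ := fun n => u (n + 2) / u (n + 1) with hrdef
    have hrpos : ∀ n, 0 < r n := fun n => div_pos (hpos _) (hpos _)
    have hrr : ∀ n, r (n + 1) * r n = τ * r n - δ := by
      intro n
      have h1 := (hpos n).ne'
      have h2 : u (n + 1 + 1) ≠ 0 := (hpos (n+1)).ne'
      have h3 := hr (n + 1)
      simp only [hrdef]
      have e : u (n + 1 + 2) = τ * u (n + 2) - δ * u (n + 1) := h3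
      rw [e]
      have h2' : u (n + 2) ≠ 0 := h2
      have h2'' : u (n + 1 + 1) = u (n + 2) := rfl
      rw [h2'']
      field_simp
    have hanti : Antitone r := by
      apply antitone_nat_of_succ_le
      intro n
      have h1 := hrpos n
      have h2 := hrr n
      by_contra hcon
      push Not at hcon
      nlinarith [mul_pos (sub_pos.mpr hcon) h1, sq_nonneg (2 * r n - τ)]
    have hlim := tendsto_atTop_ciInf hanti ⟨0, by rintro _ ⟨n, rfl⟩; exact (hrpos n).le⟩
    set l := ⨅ i, r i
    have hlim1 := hlim.comp (Filter.tendsto_add_atTop_nat 1)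
    have e1 := hlim1.mul hlim
    have e2 := (hlim.const_mul τ).sub_const δ
    have e3 : l * l = τ * l - δ := by
      refine tendsto_nhds_unique e1 (e2.congr fun n => ?_)
      simp only [Function.comp]
      exact (hrr n).symm
    nlinarith [sq_nonneg (2 * l - τ)]

theorem ch_sup (I J : Set ℝ) (α β : ℝ) (hα : 0 < α) (hJI : J ⊆ I)
    (hI : I.OrdConnected) (hJ : J.OrdConnected)
    (hg : ∀ r, r ∈ J ↔ α * r + β ∈ J) (hfix : ∀ r ∈ I, α * r + β ≠ r)
    (s : ℝ) (hs : s ∈ J) (q : ℝ) (hq : q ∈ I) (hsq : s ≤ q) : q ∈ J := by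
  by_contra hqJ
  have hbd : ∀ r ∈ J, r ≤ q := by
    intro r hr
    by_contra h
    push Not at h
    exact hqJ (hJ.out hs hr ⟨hsq, h.le⟩)
  have hlub : IsLUB J (sSup J) := isLUB_csSup ⟨s, hs⟩ ⟨q, hbd⟩
  have h1 : s ≤ sSup J := hlub.1 hs
  have h2 : sSup J ≤ q := hlub.2 hbd
  have hlub2 : IsLUB J (α * sSup J + β) := by
    constructor
    · intro r hr
      have hr' : (r - β) / α ∈ J := by
        rw [hg]
        have : α * ((r - β) / α) + β = r := by field_simp; ring
        rwa [this]
      have := hlub.1 hr'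
      rw [div_le_iff₀ hα] at this
      linarith
    · intro b hb
      have : sSup J ≤ (b - β) / α := by
        apply hlub.2
        intro r hr
        rw [le_div_iff₀ hα]
        have := hb ((hg r).mp hr)
        linarith
      rw [le_div_iff₀ hα] at this
      linarith
  exact hfix _ (hI.out (hJI hs) hq ⟨h1, h2⟩) (hlub2.unique hlub)

theorem ch_interval (I J : Set ℝ) (α β : ℝ) (hα : 0 < α) (hJI : J ⊆ I)
    (hI : I.OrdConnected) (hJ : J.OrdConnected)
    (hg : ∀ r, r ∈ J ↔ α * r + β ∈ J) (hfix : ∀ r ∈ I, α * r + β ≠ r)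
    (s : ℝ) (hs : s ∈ J) (q : ℝ) (hq : q ∈ I) : q ∈ J := by
  rcases le_total s q with h | h
  · exact ch_sup I J α β hα hJI hI hJ hg hfix s hs q hq h
  · have oc : ∀ K : Set ℝ, K.OrdConnected → (Neg.neg ⁻¹' K).OrdConnected := by
      intro K hK
      refine ⟨fun x hx y hy z hz => ?_⟩
      exact hK.out hy hx ⟨neg_le_neg hz.2, neg_le_neg hz.1⟩
    have := ch_sup (Neg.neg ⁻¹' I) (Neg.neg ⁻¹' J) α (-β) hα (fun x hx => hJI hx)
      (oc I hI) (oc J hJ) ?_ ?_ (-s) (by simpa using hs) (-q) (by simpa using hq) (neg_le_neg h)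
    · simpa using this
    · intro r
      simp only [Set.mem_preimage]
      rw [hg]
      ring_nf
    · intro r hr hcon
      exact hfix _ hr (by linarith)

theorem ch_eig (A : Matrix (Fin 3) (Fin 3) ℝ) (hA : A.det = 1) :
    ∃ l : ℝ, 0 < l ∧ ∃ v : Fin 3 → ℝ, v ≠ 0 ∧ A *ᵥ v = l • v := by
  set f : ℝ → ℝ := fun t => (t • (1 : Matrix (Fin 3) (Fin 3) ℝ) - A).det with hf
  obtain ⟨p, q, hpq⟩ : ∃ p q : ℝ, ∀ t, f t = t ^ 3 + p * t ^ 2 + q * t - 1 := by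
    refine ⟨-(A 0 0 + A 1 1 + A 2 2), A 0 0 * A 1 1 - A 0 1 * A 1 0 + A 0 0 * A 2 2
      - A 0 2 * A 2 0 + A 1 1 * A 2 2 - A 1 2 * A 2 1, fun t => ?_⟩
    rw [← hA]
    simp only [hf, det_fin_three, Matrix.sub_apply, Matrix.smul_apply, smul_eq_mul]
    simp [one_apply]
    ring
  have hc : Continuous f := by
    rw [show f = fun t => t ^ 3 + p * t ^ 2 + q * t - 1 from funext hpq]
    fun_prop
  set M := 1 + |p| + |q|
  have h0M : (0:ℝ) ≤ M := by positivity
  have hM : 0 ≤ f M := by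
    rw [hpq]
    have h1 : 1 ≤ M := by have := abs_nonneg p; have := abs_nonneg q; simp only [M]; linarith
    have h2 := neg_abs_le p
    have h3 := neg_abs_le q
    have h4 : M ^ 3 = M ^ 2 + |p| * M ^ 2 + |q| * M ^ 2 := by simp only [M]; ring
    have h5 : 0 ≤ (p + |p|) * M ^ 2 := mul_nonneg (by linarith) (by positivity)
    have h6 : 0 ≤ (q + |q|) * M := mul_nonneg (by linarith) (by positivity)
    have h7 : 0 ≤ |q| * (M * (M - 1)) :=
      mul_nonneg (abs_nonneg q) (mul_nonneg h0M (by linarith))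
    nlinarith
  have h0 : f 0 ≤ 0 := by rw [hpq]; norm_num
  obtain ⟨l, hl, hfl⟩ := intermediate_value_Icc h0M hc.continuousOn ⟨h0, hM⟩
  have hl0 : l ≠ 0 := by
    rintro rfl
    rw [hpq] at hfl
    norm_num at hfl
  obtain ⟨v, hv, hv2⟩ := exists_mulVec_eq_zero_iff.mpr hfl
  refine ⟨l, lt_of_le_of_ne hl.1 (Ne.symm hl0), v, hv, ?_⟩
  rw [sub_mulVec, smul_mulVec, one_mulVec, sub_eq_zero] at hv2
  exact hv2.symm

theorem ch_frame (v : Fin 3 → ℝ) (hv : v ≠ 0) :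
    ∃ P : Matrix (Fin 3) (Fin 3) ℝ, P.det ≠ 0 ∧ P *ᵥ ![1, 0, 0] = v := by
  by_cases h0 : v 0 = 0
  · by_cases h1 : v 1 = 0
    · have h2 : v 2 ≠ 0 := by
        intro h2; apply hv; ext i; fin_cases i <;> simp [h0, h1, h2]
      refine ⟨!![v 0, 1, 0; v 1, 0, 1; v 2, 0, 0], by simp [det_fin_three, h2], ?_⟩
      ext i; fin_cases i <;> simp [mulVec, dotProduct, Fin.sum_univ_three]
    · refine ⟨!![v 0, 1, 0; v 1, 0, 0; v 2, 0, 1], by simp [det_fin_three, h1], ?_⟩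
      ext i; fin_cases i <;> simp [mulVec, dotProduct, Fin.sum_univ_three]
  · refine ⟨!![v 0, 0, 0; v 1, 1, 0; v 2, 0, 1], by simp [det_fin_three, h0], ?_⟩
    ext i; fin_cases i <;> simp [mulVec, dotProduct, Fin.sum_univ_three]

theorem ch_block (A : Matrix (Fin 3) (Fin 3) ℝ) (hA : A.det = 1) :
    ∃ (P : Matrix (Fin 3) (Fin 3) ℝ) (l r s a b c d : ℝ), P.det ≠ 0 ∧ 0 < l ∧
      l * (a * d - b * c) = 1 ∧ A * P = P * !![l, r, s; 0, a, b; 0, c, d] := by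
  obtain ⟨l, hl, v, hv, hAv⟩ := ch_eig A hA
  obtain ⟨P, hP, hPv⟩ := ch_frame v hv
  have hu : IsUnit P.det := isUnit_iff_ne_zero.mpr hP
  set B := P⁻¹ * A * P with hB
  have hAP : A * P = P * B := by
    rw [hB, ← Matrix.mul_assoc, ← Matrix.mul_assoc, mul_nonsing_inv _ hu, Matrix.one_mul]
  have hBe : B *ᵥ ![1, 0, 0] = l • ![1, 0, 0] := by
    rw [hB, ← mulVec_mulVec, hPv, ← mulVec_mulVec, hAv, mulVec_smul, ← hPv, mulVec_mulVec,
      nonsing_inv_mul _ hu, one_mulVec]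
  have e0 : B 0 0 = l := by
    have := congrFun hBe 0; simpa [mulVec, dotProduct, Fin.sum_univ_three] using this
  have e1 : B 1 0 = 0 := by
    have := congrFun hBe 1; simpa [mulVec, dotProduct, Fin.sum_univ_three] using this
  have e2 : B 2 0 = 0 := by
    have := congrFun hBe 2; simpa [mulVec, dotProduct, Fin.sum_univ_three] using this
  have hdet : B.det = 1 := by
    have := congrArg det hAP
    rw [det_mul, det_mul, hA, one_mul] at this
    exact mul_left_cancel₀ hP (by rw [← this, mul_one])
  refine ⟨P, l, B 0 1, B 0 2, B 1 1, B 1 2, B 2 1, B 2 2, hP, hl, ?_, ?_⟩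
  · rw [det_fin_three, e0, e1, e2] at hdet
    linarith
  · rw [hAP]
    congr 1
    ext i j; fin_cases i <;> fin_cases j <;> simp [e0, e1, e2]

theorem ch_conj {A P B Q B' : Matrix (Fin 3) (Fin 3) ℝ} (h : A * P = P * B) (h' : B * Q = Q * B') :
    A * (P * Q) = (P * Q) * B' := by
  rw [← Matrix.mul_assoc, h, Matrix.mul_assoc, h', Matrix.mul_assoc]

theorem ch_kill (l r s a b c d : ℝ) (h : (a - l) * (d - l) - b * c ≠ 0) :
    ∃ x y : ℝ, l * x + r = a * x + c * y ∧ l * y + s = b * x + d * y := by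
  set D := (a - l) * (d - l) - b * c with hD
  refine ⟨(r * (d - l) - c * s) / D, ((a - l) * s - b * r) / D, ?_, ?_⟩
  · field_simp; rw [hD]; ring
  · field_simp; rw [hD]; ring

theorem ch_reduce (A : Matrix (Fin 3) (Fin 3) ℝ) (hA : A.det = 1) :
    (∃ (P : Matrix (Fin 3) (Fin 3) ℝ) (l m n r s t : ℝ), P.det ≠ 0 ∧ 0 < l ∧ 0 < m ∧ 0 < n ∧
      A * P = P * !![l, r, s; 0, m, t; 0, 0, n]) ∨
    (∃ (P : Matrix (Fin 3) (Fin 3) ℝ) (l a b c d : ℝ), P.det ≠ 0 ∧ 0 < l ∧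
      (a - d) ^ 2 + 4 * b * c < 0 ∧ A * P = P * !![a, b, 0; c, d, 0; 0, 0, l]) ∨
    (∃ (P : Matrix (Fin 3) (Fin 3) ℝ) (l m n t : ℝ), P.det ≠ 0 ∧ 0 < l ∧ m < 0 ∧ n < 0 ∧
      A * P = P * !![l, 0, 0; 0, m, t; 0, 0, n]) := by
  obtain ⟨P, l, r, s, a, b, c, d, hP, hl, hdet, hAP⟩ := ch_block A hA
  by_cases hdisc : (a - d) ^ 2 + 4 * b * c < 0
  · right; left
    obtain ⟨x, y, h1, h2⟩ := ch_kill l r s a b c d (by nlinarith [sq_nonneg (a + d - 2 * l)])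
    refine ⟨P * !![x, y, 1; 1, 0, 0; 0, 1, 0], l, a, b, c, d, ?_, hl, hdisc, ch_conj hAP ?_⟩
    · rw [det_mul]; exact mul_ne_zero hP (by simp [det_fin_three])
    · ext i j; fin_cases i <;> fin_cases j <;> simp [mul_apply, Fin.sum_univ_three] <;> linarith
  · push Not at hdisc
    have htri : ∃ (P : Matrix (Fin 3) (Fin 3) ℝ) (m n r s t : ℝ), P.det ≠ 0 ∧
        m * n = a * d - b * c ∧ A * P = P * !![l, r, s; 0, m, t; 0, 0, n] := by
      by_cases hc : c = 0
      · subst hc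
        exact ⟨P, a, d, r, s, b, hP, by ring, hAP⟩
      · set m := (a + d + Real.sqrt ((a - d) ^ 2 + 4 * b * c)) / 2 with hm
        have hm2 : m * (a + d - m) = a * d - b * c := by
          have := Real.sq_sqrt hdisc
          rw [hm]; linear_combination (-1/4) * this
        refine ⟨P * !![1, 0, 0; 0, m - d, 1; 0, c, 0], m, a + d - m,
          r * (m - d) + s * c, r, 1, ?_, hm2, ch_conj hAP ?_⟩
        · rw [det_mul]; exact mul_ne_zero hP (by simp [det_fin_three, hc])
        · ext i j; fin_cases i <;> fin_cases j <;> simp [mul_apply, Fin.sum_univ_three] <;> linarith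
    obtain ⟨P, m, n, r, s, t, hP, hmn, hAP⟩ := htri
    have hmn0 : 0 < m * n := by
      rw [hmn]; by_contra h; push Not at h; nlinarith
    rcases pos_and_pos_or_neg_and_neg_of_mul_pos hmn0 with ⟨hm, hn⟩ | ⟨hm, hn⟩
    · left
      exact ⟨P, l, m, n, r, s, t, hP, hl, hm, hn, hAP⟩
    · right; right
      obtain ⟨x, y, h1, h2⟩ := ch_kill l r s m t 0 n
        (by have : 0 < (m - l) * (n - l) := mul_pos_of_neg_of_neg (by linarith) (by linarith)
            simpa using this.ne')
      refine ⟨P * !![1, x, y; 0, 1, 0; 0, 0, 1], l, m, n, t, ?_, hl, hm, hn, ch_conj hAP ?_⟩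
      · rw [det_mul]; exact mul_ne_zero hP (by simp [det_fin_three])
      · ext i j; fin_cases i <;> fin_cases j <;> simp [mul_apply, Fin.sum_univ_three] <;> linarith

/-- The properties of the cone over `Ω` (in linear coordinates) that the argument uses. -/
structure ChGood (A : Matrix (Fin 3) (Fin 3) ℝ) (C : Set (Fin 3 → ℝ)) : Prop where
  smul : ∀ c : ℝ, c ≠ 0 → ∀ u, c • u ∈ C ↔ u ∈ C
  zero : (0 : Fin 3 → ℝ) ∉ C
  inv : ∀ u, A *ᵥ u ∈ C ↔ u ∈ C
  free : ∀ u ∈ C, ∀ c : ℝ, A *ᵥ u ≠ c • u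
  sign : ∀ k f g : (Fin 3 → ℝ) →ₗ[ℝ] ℝ, k ≠ 0 → (∀ u ∈ C, k u = 0 → f u * g u ≠ 0) →
    ∀ u ∈ C, ∀ w ∈ C, k u = 0 → k w = 0 → 0 < f u * g u → 0 < f w * g w
  omits : ∀ k : (Fin 3 → ℝ) →ₗ[ℝ] ℝ, k ≠ 0 → ∃ w, w ≠ 0 ∧ k w = 0 ∧ w ∉ C
  strict : ∀ k : (Fin 3 → ℝ) →ₗ[ℝ] ℝ, k ≠ 0 → (∀ u ∈ C, k u = 0 → u ∉ interior C) →
    ∀ u ∈ C, ∀ w ∈ C, k u = 0 → k w = 0 → ∃ c : ℝ, w = c • u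
  ne : C.Nonempty
  bd : (C \ interior C).Nonempty
  bdsign : ∀ f g : (Fin 3 → ℝ) →ₗ[ℝ] ℝ, (∀ u ∈ C \ interior C, f u * g u ≠ 0) →
    ∀ u ∈ C \ interior C, ∀ w ∈ C \ interior C, 0 < f u * g u → 0 < f w * g w

/-- Interiors are compatible with invertible matrices. -/
theorem ch_interior (P : Matrix (Fin 3) (Fin 3) ℝ) (hP : P.det ≠ 0) (C : Set (Fin 3 → ℝ))
    (u : Fin 3 → ℝ) : u ∈ interior {u | P *ᵥ u ∈ C} ↔ P *ᵥ u ∈ interior C := by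
  have hu : IsUnit P.det := isUnit_iff_ne_zero.mpr hP
  have hc : Continuous (fun u => P *ᵥ u) := by fun_prop
  have ho : IsOpenMap (fun u => P *ᵥ u) := by
    apply IsOpenMap.of_inverse (f' := fun u => P⁻¹ *ᵥ u) (by fun_prop)
    · intro u; simp [mulVec_mulVec, mul_nonsing_inv _ hu]
    · intro u; simp [mulVec_mulVec, nonsing_inv_mul _ hu]
  have := ho.preimage_interior_eq_interior_preimage hc C
  change u ∈ interior ((fun u => P *ᵥ u) ⁻¹' C) ↔ _
  rw [← this]
  rfl

theorem ch_interior_inv (P : Matrix (Fin 3) (Fin 3) ℝ) (hP : P.det ≠ 0) (C : Set (Fin 3 → ℝ))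
    (h : ∀ u, P *ᵥ u ∈ C ↔ u ∈ C) (u : Fin 3 → ℝ) : P *ᵥ u ∈ interior C ↔ u ∈ interior C := by
  have := ch_interior P hP C u
  rw [← this]
  have e : {u | P *ᵥ u ∈ C} = C := by ext u; exact h u
  rw [e]

theorem ch_interior_smul (C : Set (Fin 3 → ℝ)) (c : ℝ) (hc : c ≠ 0)
    (h : ∀ u, c • u ∈ C ↔ u ∈ C) (u : Fin 3 → ℝ) : c • u ∈ interior C ↔ u ∈ interior C := by
  have := ch_interior_inv (c • 1) (by simp [hc]) C (by simpa [smul_mulVec] using h) u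
  simpa [smul_mulVec] using this

theorem ChGood.transport {A P B : Matrix (Fin 3) (Fin 3) ℝ} {C : Set (Fin 3 → ℝ)}
    (h : ChGood A C) (hP : P.det ≠ 0) (hAP : A * P = P * B) : ChGood B {u | P *ᵥ u ∈ C} := by
  have hu : IsUnit P.det := isUnit_iff_ne_zero.mpr hP
  have hPP : ∀ u, P *ᵥ (P⁻¹ *ᵥ u) = u := fun u => by
    simp [mulVec_mulVec, mul_nonsing_inv _ hu]
  have hPP' : ∀ u, P⁻¹ *ᵥ (P *ᵥ u) = u := fun u => by
    simp [mulVec_mulVec, nonsing_inv_mul _ hu]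
  have hAB : ∀ u, P *ᵥ (B *ᵥ u) = A *ᵥ (P *ᵥ u) := fun u => by
    rw [mulVec_mulVec, mulVec_mulVec, hAP]
  have hk0 : ∀ k : (Fin 3 → ℝ) →ₗ[ℝ] ℝ, k ≠ 0 → k ∘ₗ (mulVecLin P⁻¹) ≠ 0 := by
    intro k hk h0
    apply hk
    ext1 i
    ext
    have := LinearMap.congr_fun h0 (P *ᵥ (Pi.single i 1))
    simp only [LinearMap.comp_apply, mulVecLin_apply, hPP'] at this
    simpa using this
  have hci : ∀ k : (Fin 3 → ℝ) →ₗ[ℝ] ℝ, ∀ u, (k ∘ₗ (mulVecLin P⁻¹)) (P *ᵥ u) = k u := by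
    intro k u
    simp only [LinearMap.comp_apply, mulVecLin_apply, hPP']
  have hci' : ∀ k : (Fin 3 → ℝ) →ₗ[ℝ] ℝ, ∀ u, (k ∘ₗ (mulVecLin P⁻¹)) u = k (P⁻¹ *ᵥ u) := by
    intro k u
    rfl
  have hbdd : ∀ u, u ∈ {u | P *ᵥ u ∈ C} \ interior {u | P *ᵥ u ∈ C} ↔
      P *ᵥ u ∈ C \ interior C := by
    intro u
    rw [Set.mem_sdiff, Set.mem_sdiff, ch_interior P hP]
    rfl
  refine ⟨?_, ?_, ?_, ?_, ?_, ?_, ?_, ?_, ?_, ?_⟩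
  · intro c hc u
    simp only [Set.mem_ofPred_eq, mulVec_smul]
    exact h.smul c hc _
  · simp only [Set.mem_ofPred_eq, mulVec_zero]
    exact h.zero
  · intro u
    simp only [Set.mem_ofPred_eq, hAB]
    exact h.inv _
  · intro u hu c hc
    apply h.free _ hu c
    rw [← hAB, hc, mulVec_smul]
  · intro k f g hk hfg u hu w hw hku hkw hpos
    have := h.sign _ (f ∘ₗ (mulVecLin P⁻¹)) (g ∘ₗ (mulVecLin P⁻¹)) (hk0 k hk) ?_ _ hu _ hw
      (by rwa [hci]) (by rwa [hci]) (by rwa [hci, hci])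
    · rwa [hci, hci] at this
    · intro x hx hkx
      rw [hci'] at hkx ⊢
      rw [hci']
      exact hfg _ (by simpa only [Set.mem_ofPred_eq, hPP] using hx) hkx
  · intro k hk
    obtain ⟨w, hw, hkw, hwC⟩ := h.omits _ (hk0 k hk)
    refine ⟨P⁻¹ *ᵥ w, ?_, hkw, by simpa only [Set.mem_ofPred_eq, hPP] using hwC⟩
    intro h0
    apply hw
    rw [← hPP w, h0, mulVec_zero]
  · intro k hk hint u hu w hw hku hkw
    have hint' : ∀ x ∈ C, (k ∘ₗ (mulVecLin P⁻¹)) x = 0 → x ∉ interior C := by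
      intro x hx hkx
      have := hint (P⁻¹ *ᵥ x) (by simpa only [Set.mem_ofPred_eq, hPP] using hx) hkx
      rwa [ch_interior P hP, hPP] at this
    obtain ⟨c, hc⟩ := h.strict _ (hk0 k hk) hint' _ hu _ hw (by rwa [hci]) (by rwa [hci])
    refine ⟨c, ?_⟩
    rw [← hPP' w, hc, mulVec_smul, hPP']
  · obtain ⟨u, hu⟩ := h.ne
    exact ⟨P⁻¹ *ᵥ u, by simpa only [Set.mem_ofPred_eq, hPP] using hu⟩
  · obtain ⟨u, hu⟩ := h.bd
    refine ⟨P⁻¹ *ᵥ u, (hbdd _).mpr ?_⟩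
    rwa [hPP]
  · intro f g hfg u hu w hw hpos
    rw [hbdd] at hu hw
    have := h.bdsign (f ∘ₗ (mulVecLin P⁻¹)) (g ∘ₗ (mulVecLin P⁻¹)) ?_ _ hu _ hw
      (by rwa [hci, hci])
    · rwa [hci, hci] at this
    · intro x hx
      rw [hci', hci']
      exact hfg _ ((hbdd _).mpr (by rwa [hPP]))

/-- The linear functional with given coefficients. -/
def chLin (a b c : ℝ) : (Fin 3 → ℝ) →ₗ[ℝ] ℝ :=
  a • LinearMap.proj 0 + b • LinearMap.proj 1 + c • LinearMap.proj 2

theorem chLin_apply (a b c : ℝ) (u : Fin 3 → ℝ) :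
    chLin a b c u = a * u 0 + b * u 1 + c * u 2 := by
  simp [chLin]

theorem chLin_ne (a b c : ℝ) (h : a ^ 2 + b ^ 2 + c ^ 2 ≠ 0) : chLin a b c ≠ 0 := by
  intro h0
  have := LinearMap.congr_fun h0 ![a, b, c]
  rw [chLin_apply] at this
  simp at this
  apply h
  linarith

/-- The part of the cone in the half space `z > 0` is closed under addition. -/
theorem ChGood.add {A : Matrix (Fin 3) (Fin 3) ℝ} {C : Set (Fin 3 → ℝ)}
    (h : ChGood A C) (hz : ∀ u ∈ C, u 2 ≠ 0) (u w : Fin 3 → ℝ) (hu : u ∈ C) (hw : w ∈ C)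
    (hu2 : 0 < u 2) (hw2 : 0 < w 2) : u + w ∈ C := by
  by_contra hs
  obtain ⟨a, ha⟩ : ∃ a, a = u 1 * w 2 - u 2 * w 1 := ⟨_, rfl⟩
  obtain ⟨b, hb⟩ : ∃ a, a = u 2 * w 0 - u 0 * w 2 := ⟨_, rfl⟩
  obtain ⟨c, hc⟩ : ∃ a, a = u 0 * w 1 - u 1 * w 0 := ⟨_, rfl⟩
  obtain ⟨s, hsd⟩ : ∃ s, s = u + w := ⟨_, rfl⟩
  rw [← hsd] at hs
  have s0 : s 0 = u 0 + w 0 := by rw [hsd]; rfl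
  have s1 : s 1 = u 1 + w 1 := by rw [hsd]; rfl
  have s2 : s 2 = u 2 + w 2 := by rw [hsd]; rfl
  have hspos : 0 < s 2 := by rw [s2]; linarith
  -- anything in `C` parallel to `s` gives a contradiction
  have hpar : ∀ x ∈ C, s 2 * x 0 = s 0 * x 2 → s 2 * x 1 = s 1 * x 2 → False := by
    intro x hx h0 h1
    apply hs
    have hx2 := hz x hx
    have : s = (s 2 / x 2) • x := by
      ext i
      fin_cases i
      · simp; field_simp; linarith
      · simp; field_simp; linarith
      · simp; field_simp
    rw [this]
    exact (h.smul _ (div_ne_zero hspos.ne' hx2) x).mpr hx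
  by_cases hn : a ^ 2 + b ^ 2 + c ^ 2 = 0
  · have ha0 : a = 0 := by nlinarith [sq_nonneg a, sq_nonneg b, sq_nonneg c]
    have hb0 : b = 0 := by nlinarith [sq_nonneg a, sq_nonneg b, sq_nonneg c]
    apply hpar u hu
    · rw [s2, s0]; linarith
    · rw [s2, s1]; linarith
  · have hnpos : 0 < a ^ 2 + b ^ 2 + c ^ 2 := lt_of_le_of_ne (by positivity) (Ne.symm hn)
    have hks : a * s 0 + b * s 1 + c * s 2 = 0 := by rw [s0, s1, s2, ha, hb, hc]; ring
    have key := h.sign (chLin a b c) (chLin 0 0 1)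
      (chLin (b * s 2 - c * s 1) (c * s 0 - a * s 2) (a * s 1 - b * s 0)) (chLin_ne _ _ _ hn) ?_
      w hw u hu ?_ ?_ ?_
    · rw [chLin_apply, chLin_apply] at key
      have e : (b * s 2 - c * s 1) * u 0 + (c * s 0 - a * s 2) * u 1 + (a * s 1 - b * s 0) * u 2
        = -(a ^ 2 + b ^ 2 + c ^ 2) := by rw [s0, s1, s2, ha, hb, hc]; ring
      rw [e] at key
      nlinarith
    · intro x hx hkx h0
      rw [chLin_apply] at hkx
      rw [chLin_apply, chLin_apply] at h0
      have hx2 := hz x hx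
      have h1 : (b * s 2 - c * s 1) * x 0 + (c * s 0 - a * s 2) * x 1 + (a * s 1 - b * s 0) * x 2
        = 0 := by
        rcases mul_eq_zero.mp h0 with h | h
        · exact absurd (by linarith) hx2
        · exact h
      apply hpar x hx
      · apply mul_left_cancel₀ hn
        linear_combination b * h1 + (c * x 0 - a * x 2) * hks - (c * s 0 - a * s 2) * hkx
      · apply mul_left_cancel₀ hn
        linear_combination (-a) * h1 + (c * x 1 - b * x 2) * hks - (c * s 1 - b * s 2) * hkx
    · rw [chLin_apply, ha, hb, hc]; ring
    · rw [chLin_apply, ha, hb, hc]; ring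
    · rw [chLin_apply, chLin_apply]
      have e : (b * s 2 - c * s 1) * w 0 + (c * s 0 - a * s 2) * w 1 + (a * s 1 - b * s 0) * w 2
        = (a ^ 2 + b ^ 2 + c ^ 2) := by rw [s0, s1, s2, ha, hb, hc]; ring
      rw [e]
      have : 0 < w 2 * (a ^ 2 + b ^ 2 + c ^ 2) := mul_pos hw2 hnpos
      linarith

/-- A fundamental solution of the two-term recursion. -/
def chY (τ δ : ℝ) : ℕ → ℝ
  | 0 => 0
  | 1 => 1
  | (n + 2) => τ * chY τ δ (n + 1) - δ * chY τ δ n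

/-- The elliptic case is impossible. -/
theorem ChGood.not_elliptic {l a b c d : ℝ} {C : Set (Fin 3 → ℝ)} (hl : 0 < l)
    (hdisc : (a - d) ^ 2 + 4 * b * c < 0) (h : ChGood !![a, b, 0; c, d, 0; 0, 0, l] C) :
    False := by
  set B : Matrix (Fin 3) (Fin 3) ℝ := !![a, b, 0; c, d, 0; 0, 0, l] with hB
  have B0 : ∀ u, (B *ᵥ u) 0 = a * u 0 + b * u 1 := by
    intro u; simp [hB, mulVec, dotProduct, Fin.sum_univ_three]
  have B1 : ∀ u, (B *ᵥ u) 1 = c * u 0 + d * u 1 := by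
    intro u; simp [hB, mulVec, dotProduct, Fin.sum_univ_three]
  have B2 : ∀ u, (B *ᵥ u) 2 = l * u 2 := by
    intro u; simp [hB, mulVec, dotProduct, Fin.sum_univ_three]
  obtain ⟨τ, hτ⟩ : ∃ τ, τ = a + d := ⟨_, rfl⟩
  obtain ⟨δ, hδ⟩ : ∃ δ, δ = a * d - b * c := ⟨_, rfl⟩
  have hd : τ ^ 2 < 4 * δ := by rw [hτ, hδ]; linarith
  have hδ0 : 0 < δ := by nlinarith [sq_nonneg τ]
  have hz : ∀ u ∈ C, u 2 ≠ 0 := by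
    intro u hu hu2
    obtain ⟨w, hw0, hkw, hwC⟩ := h.omits (chLin 0 0 1) (chLin_ne _ _ _ (by norm_num))
    rw [chLin_apply] at hkw
    have hw2 : w 2 = 0 := by linarith
    have hg : ∀ x ∈ C, x 2 = 0 → -w 1 * x 0 + w 0 * x 1 ≠ 0 := by
      intro x hx hx2 h0
      apply hwC
      have hx0 : x ≠ 0 := by rintro rfl; exact h.zero hx
      have : ∃ e : ℝ, w = e • x := by
        by_cases hx0' : x 0 = 0
        · have hx1 : x 1 ≠ 0 := by
            intro hx1; apply hx0; ext i; fin_cases i <;> simp [hx0', hx1, hx2]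
          refine ⟨w 1 / x 1, ?_⟩
          ext i
          fin_cases i
          · simp [hx0']
            rw [hx0'] at h0
            exact (mul_eq_zero.mp (by linarith : w 0 * x 1 = 0)).resolve_right hx1
          · simp; field_simp
          · simp [hx2, hw2]
        · refine ⟨w 0 / x 0, ?_⟩
          ext i
          fin_cases i
          · simp; field_simp
          · simp; field_simp; linarith
          · simp [hx2, hw2]
      obtain ⟨e, he⟩ := this
      have he0 : e ≠ 0 := by rintro rfl; apply hw0; rw [he, zero_smul]
      rw [he]
      exact (h.smul e he0 x).mpr hx
    have hsgn := h.sign (chLin 0 0 1) (chLin (-w 1) (w 0) 0)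
      (chLin (-w 1 * a + w 0 * c) (-w 1 * b + w 0 * d) 0) (chLin_ne _ _ _ (by norm_num)) (by
        intro x hx hkx
        rw [chLin_apply] at hkx
        have hx2 : x 2 = 0 := by linarith
        rw [chLin_apply, chLin_apply]
        apply mul_ne_zero
        · have := hg x hx hx2
          intro h0; apply this; linarith
        · have := hg _ ((h.inv x).mpr hx) (by rw [B2, hx2, mul_zero])
          rw [B0, B1] at this
          intro h0; apply this; linarith)
    simp only [chLin_apply] at hsgn
    set v : ℕ → (Fin 3 → ℝ) := fun n => (fun x => B *ᵥ x)^[n] u with hv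
    have hvs : ∀ n, v (n + 1) = B *ᵥ (v n) := by
      intro n; simp only [hv, Function.iterate_succ_apply']
    have hvC : ∀ n, v n ∈ C ∧ v n 2 = 0 := by
      intro n
      induction n with
      | zero => exact ⟨hu, hu2⟩
      | succ n ih => rw [hvs]; exact ⟨(h.inv _).mpr ih.1, by rw [B2, ih.2, mul_zero]⟩
    set y : ℕ → ℝ := fun n => -w 1 * v n 0 + w 0 * v n 1 with hy
    have hy0 : ∀ n, y n ≠ 0 := fun n => hg _ (hvC n).1 (hvC n).2
    have hyr : ∀ n, y (n + 2) = τ * y (n + 1) - δ * y n := by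
      intro n
      simp only [hy]
      rw [show n + 2 = n + 1 + 1 from rfl, hvs (n + 1), B0, B1, hvs n, B0, B1, hτ, hδ]
      ring
    have hys : ∀ n k, 0 < y n * y (n + 1) → 0 < y k * y (k + 1) := by
      intro n k hn
      have := hsgn (v n) (hvC n).1 (v k) (hvC k).1 (by rw [(hvC n).2]; ring)
        (by rw [(hvC k).2]; ring)
      simp only [hy] at hn ⊢
      rw [hvs, B0, B1] at hn ⊢
      have := this (by linarith)
      linarith
    have hσ : ∃ σ : ℝ, σ * σ = 1 ∧ ∀ n, 0 < σ * (y n * y (n + 1)) := by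
      rcases lt_or_gt_of_ne (mul_ne_zero (hy0 0) (hy0 1)) with h0 | h0
      · refine ⟨-1, by norm_num, fun n => ?_⟩
        rcases lt_or_gt_of_ne (mul_ne_zero (hy0 n) (hy0 (n + 1))) with h1 | h1
        · linarith
        · have := hys n 0 h1
          simp only [zero_add] at this
          linarith
      · refine ⟨1, by norm_num, fun n => ?_⟩
        have := hys 0 n h0
        linarith
    obtain ⟨σ, hσ2, hσy⟩ := hσ
    have hpos : ∀ n, 0 < σ ^ n * (y 0 * y n) := by
      intro n
      induction n with
      | zero => simpa using mul_self_pos.mpr (hy0 0)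
      | succ n ih =>
        have h1 := mul_pos ih (hσy n)
        have h2 : σ ^ n * (y 0 * y n) * (σ * (y n * y (n + 1)))
          = (y n * y n) * (σ ^ (n + 1) * (y 0 * y (n + 1))) := by ring
        rw [h2] at h1
        exact pos_of_mul_pos_right h1 (mul_self_nonneg _)
    have := ch_recur (fun n => σ ^ n * (y 0 * y n)) (σ * τ) δ
      (by have : (σ * τ) ^ 2 = (σ * σ) * τ ^ 2 := by ring
          rw [this, hσ2, one_mul]; exact hd) (fun n => (hpos n).le) (by
        intro n
        rw [hyr]
        have : σ ^ (n + 2) = σ ^ n := by rw [pow_add, pow_two, hσ2, mul_one]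
        have e2 : σ ^ (n + 1) * σ = σ ^ n := by rw [← this]; ring
        rw [this]
        linear_combination (-τ * y 0 * y (n+1)) * e2)
    exact (hpos 0).ne' this.1
  obtain ⟨u, hu, hu2⟩ : ∃ u ∈ C, 0 < u 2 := by
    obtain ⟨u, hu⟩ := h.ne
    rcases lt_or_gt_of_ne (hz u hu) with h0 | h0
    · refine ⟨(-1 : ℝ) • u, (h.smul _ (by norm_num) u).mpr hu, ?_⟩
      simp; exact h0
    · exact ⟨u, hu, h0⟩
  obtain ⟨n, hn⟩ : ∃ n, chY τ δ n < 0 := by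
    by_contra hcon
    push Not at hcon
    have := ch_recur (chY τ δ) τ δ hd hcon (fun n => rfl)
    have := this.2
    simp [chY] at this
  classical
  obtain ⟨m, hm1, hm0⟩ : ∃ m, chY τ δ (m + 1) < 0 ∧ 0 ≤ chY τ δ m := by
    have hex : ∃ n, chY τ δ n < 0 := ⟨n, hn⟩
    have h1 := Nat.find_spec hex
    have h2 : Nat.find hex ≠ 0 := by
      intro h0; rw [h0] at h1; simp [chY] at h1
    obtain ⟨m, hm⟩ := Nat.exists_eq_succ_of_ne_zero h2
    refine ⟨m, ?_, ?_⟩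
    · rw [hm] at h1; exact h1
    · have := Nat.find_min hex (m := m) (by omega)
      push Not at this
      exact this
  set v : ℕ → (Fin 3 → ℝ) := fun n => (fun x => B *ᵥ x)^[n] u with hv
  have hvs : ∀ n, v (n + 1) = B *ᵥ (v n) := by
    intro n; simp only [hv, Function.iterate_succ_apply']
  have hvC : ∀ n, v n ∈ C ∧ 0 < v n 2 := by
    intro n
    induction n with
    | zero => exact ⟨hu, hu2⟩
    | succ n ih => rw [hvs]; exact ⟨(h.inv _).mpr ih.1, by rw [B2]; exact mul_pos hl ih.2⟩
  have hvY : ∀ n, v (n + 1) 0 = chY τ δ (n + 1) * v 1 0 - δ * chY τ δ n * v 0 0 ∧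
      v (n + 1) 1 = chY τ δ (n + 1) * v 1 1 - δ * chY τ δ n * v 0 1 := by
    intro n
    have e0 : v 1 0 = a * v 0 0 + b * v 0 1 := by rw [hvs 0, B0]
    have e1 : v 1 1 = c * v 0 0 + d * v 0 1 := by rw [hvs 0, B1]
    induction n with
    | zero => simp [chY]
    | succ n ih =>
      rw [hvs (n + 1), B0, B1, ih.1, ih.2]
      have : chY τ δ (n + 1 + 1) = τ * chY τ δ (n + 1) - δ * chY τ δ n := rfl
      rw [this, e0, e1, hτ, hδ]
      constructor <;> ring
  have hsm : ∀ e : ℝ, 0 < e → ∀ x, x ∈ C ∧ 0 < x 2 → e • x ∈ C ∧ 0 < (e • x) 2 := by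
    intro e he x hx
    exact ⟨(h.smul e he.ne' x).mpr hx.1, by simpa using mul_pos he hx.2⟩
  have hadd : ∀ x, x ∈ C ∧ 0 < x 2 → ∀ y, y ∈ C ∧ 0 < y 2 → x + y ∈ C ∧ 0 < (x + y) 2 := by
    intro x hx y hy
    exact ⟨h.add hz x y hx.1 hy.1 hx.2 hy.2, by simpa using add_pos hx.2 hy.2⟩
  have h1 := hadd _ (hvC (m + 1)) _ (hsm (-chY τ δ (m + 1)) (by linarith) _ (hvC 1))
  have h2 : ∃ s, s ∈ C ∧ s 0 = 0 ∧ s 1 = 0 := by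
    rcases hm0.eq_or_lt with h0 | h0
    · refine ⟨_, h1.1, ?_, ?_⟩
      · simp [(hvY m).1, ← h0]
      · simp [(hvY m).2, ← h0]
    · have h3 := hadd _ h1 _ (hsm (δ * chY τ δ m) (mul_pos hδ0 h0) _ (hvC 0))
      refine ⟨_, h3.1, ?_, ?_⟩
      · simp [(hvY m).1]; ring
      · simp [(hvY m).2]; ring
  obtain ⟨s, hs, hs0, hs1⟩ := h2
  apply h.free s hs l
  ext i
  fin_cases i
  · have := B0 s; simp [hs0, hs1] at this ⊢; exact this
  · have := B1 s; simp [hs0, hs1] at this ⊢; exact this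
  · have := B2 s; simpa using this

/-- The orientation-reversing case is impossible. -/
theorem ChGood.not_reversing {l m n t : ℝ} {C : Set (Fin 3 → ℝ)} (hl : 0 < l) (hm : m < 0)
    (hn : n < 0) (h : ChGood !![l, 0, 0; 0, m, t; 0, 0, n] C) : False := by
  set B : Matrix (Fin 3) (Fin 3) ℝ := !![l, 0, 0; 0, m, t; 0, 0, n] with hB
  have B0 : ∀ u, (B *ᵥ u) 0 = l * u 0 := by
    intro u; simp [hB, mulVec, dotProduct, Fin.sum_univ_three]
  have B1 : ∀ u, (B *ᵥ u) 1 = m * u 1 + t * u 2 := by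
    intro u; simp [hB, mulVec, dotProduct, Fin.sum_univ_three]
  have B2 : ∀ u, (B *ᵥ u) 2 = n * u 2 := by
    intro u; simp [hB, mulVec, dotProduct, Fin.sum_univ_three]
  have hBdet : B.det ≠ 0 := by
    rw [hB]; simp [det_fin_three, hl.ne', hm.ne, hn.ne]
  have hz : ∀ u ∈ C, u 2 ≠ 0 := by
    intro u hu hu2
    have hnz : ∀ x ∈ C, x 2 = 0 → x 0 * x 1 ≠ 0 := by
      intro x hx hx2 h0
      rcases mul_eq_zero.mp h0 with h0 | h0
      · apply h.free x hx m
        ext i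
        fin_cases i
        · have := B0 x; simpa [h0] using this
        · have := B1 x; simpa [hx2] using this
        · have := B2 x; simpa [hx2] using this
      · apply h.free x hx l
        ext i
        fin_cases i
        · have := B0 x; simpa using this
        · have := B1 x; simpa [hx2, h0] using this
        · have := B2 x; simpa [hx2] using this
    have hsgn := h.sign (chLin 0 0 1) (chLin 1 0 0) (chLin 0 1 0) (chLin_ne _ _ _ (by norm_num))
      (by
        intro x hx hkx
        rw [chLin_apply] at hkx ⊢
        rw [chLin_apply]
        have := hnz x hx (by linarith)
        simpa using this)
    have hlm : l * m < 0 := mul_neg_of_pos_of_neg hl hm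
    have hBu := (h.inv u).mpr hu
    simp only [chLin_apply] at hsgn
    have e2 : (B *ᵥ u) 2 = 0 := by rw [B2, hu2, mul_zero]
    have h1 := hsgn u hu _ hBu (by rw [hu2]; ring) (by rw [e2]; ring)
    have h2 := hsgn _ hBu u hu (by rw [e2]; ring) (by rw [hu2]; ring)
    rw [B0, B1, e2, hu2] at h1 h2
    rcases lt_or_gt_of_ne (hnz u hu hu2) with h0 | h0
    · have := h2 (by nlinarith)
      linarith
    · have := h1 (by linarith)
      nlinarith
  have hneg : ∀ u, -u ∈ C ↔ u ∈ C := by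
    intro u
    have := h.smul (-1) (by norm_num) u
    simpa using this
  have hintneg : ∀ u, -u ∈ interior C ↔ u ∈ interior C := by
    intro u
    have := ch_interior_smul C (-1) (by norm_num) (h.smul (-1) (by norm_num)) u
    simpa using this
  have hintB : ∀ u, B *ᵥ u ∈ interior C ↔ u ∈ interior C := ch_interior_inv B hBdet C h.inv
  -- a boundary point on the invariant line
  obtain ⟨q, hqC, hqI, hq0, hq2⟩ : ∃ q ∈ C, q ∉ interior C ∧ q 0 = 0 ∧ 0 < q 2 := by
    have hex : ∃ q ∈ C, q ∉ interior C ∧ q 0 = 0 := by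
      by_contra hcon
      push Not at hcon
      have hsgn := h.bdsign (chLin 1 0 0) (chLin 0 0 1) (by
        intro x hx
        rw [chLin_apply, chLin_apply]
        have := mul_ne_zero (hcon x hx.1 hx.2) (hz x hx.1)
        simpa using this)
      simp only [chLin_apply] at hsgn
      obtain ⟨u, hu⟩ := h.bd
      have hBu : B *ᵥ u ∈ C \ interior C := ⟨(h.inv u).mpr hu.1, fun h0 => hu.2 ((hintB u).mp h0)⟩
      have h1 := hsgn u hu _ hBu
      have h2 := hsgn _ hBu u hu
      rw [B0, B1, B2] at h1 h2
      have hln : l * n < 0 := mul_neg_of_pos_of_neg hl hn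
      rcases lt_or_gt_of_ne (mul_ne_zero (hcon u hu.1 hu.2) (hz u hu.1)) with h0 | h0
      · have := h2 (by nlinarith)
        linarith
      · have := h1 (by linarith)
        nlinarith
    obtain ⟨q, hqC, hqI, hq0⟩ := hex
    rcases lt_or_gt_of_ne (hz q hqC) with h0 | h0
    · refine ⟨-q, (hneg q).mpr hqC, fun h1 => hqI ((hintneg q).mp h1), by simp [hq0], ?_⟩
      simpa using h0
    · exact ⟨q, hqC, hqI, hq0, h0⟩
  by_cases hemp : ∃ u, u ∈ interior C
  · obtain ⟨D, hD⟩ : ∃ D : Set (Fin 3 → ℝ), D = {u | u ∈ C ∧ 0 < u 2} := ⟨_, rfl⟩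
    have memD : ∀ u, u ∈ D ↔ u ∈ C ∧ 0 < u 2 := by intro u; rw [hD]; rfl
    have hDsm : ∀ e : ℝ, 0 < e → ∀ u, e • u ∈ D ↔ u ∈ D := by
      intro e he u
      rw [memD, memD, h.smul e he.ne']
      simp [he]
    have hDadd : ∀ u ∈ D, ∀ w ∈ D, u + w ∈ D := by
      intro u hu w hw
      rw [memD] at *
      exact ⟨h.add hz u w hu.1 hw.1 hu.2 hw.2, by simpa using add_pos hu.2 hw.2⟩
    have hDconv : Convex ℝ D := by
      rw [convex_iff_forall_pos]
      intro u hu w hw a b ha hb _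
      exact hDadd _ ((hDsm a ha u).mpr hu) _ ((hDsm b hb w).mpr hw)
    have hDN : ∀ u, (-B) *ᵥ u ∈ D ↔ u ∈ D := by
      intro u
      rw [memD, memD, neg_mulVec, hneg, h.inv, Pi.neg_apply, B2]
      constructor
      · rintro ⟨h1, h2⟩; exact ⟨h1, by nlinarith⟩
      · rintro ⟨h1, h2⟩; exact ⟨h1, by nlinarith⟩
    have hEN : ∀ u, (-B) *ᵥ u ∈ interior D ↔ u ∈ interior D :=
      ch_interior_inv (-B) (by rw [det_neg]; simpa using hBdet) D hDN
    have hEsm : ∀ e : ℝ, 0 < e → ∀ u, e • u ∈ interior D ↔ u ∈ interior D :=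
      fun e he => ch_interior_smul D e he.ne' (hDsm e he)
    have hEadd : ∀ u ∈ interior D, ∀ w ∈ interior D, u + w ∈ interior D := by
      intro u hu w hw
      have := hDconv.interior hu hw (a := 1/2) (b := 1/2) (by norm_num) (by norm_num) (by norm_num)
      rw [← smul_add, hEsm _ (by norm_num)] at this
      exact this
    have hopen : IsOpen {u : Fin 3 → ℝ | 0 < u 2} :=
      isOpen_lt continuous_const (continuous_apply 2)
    have hED : ∀ u, u ∈ interior D ↔ u ∈ interior C ∧ 0 < u 2 := by
      intro u
      have : D = C ∩ {u | 0 < u 2} := by rw [hD]; rfl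
      rw [this, interior_inter, hopen.interior_eq]
      rfl
    obtain ⟨u, hu⟩ : ∃ u, u ∈ interior D := by
      obtain ⟨u, hu⟩ := hemp
      rcases lt_or_gt_of_ne (hz u (interior_subset hu)) with h0 | h0
      · refine ⟨-u, (hED _).mpr ⟨(hintneg u).mpr hu, by simpa using h0⟩⟩
      · exact ⟨u, (hED _).mpr ⟨hu, h0⟩⟩
    obtain ⟨s, hs, hs0⟩ : ∃ s ∈ interior D, s 0 = 0 := by
      refine ⟨l • u + (-B) *ᵥ u, hEadd _ ((hEsm l hl u).mpr hu) _ ((hEN u).mpr hu), ?_⟩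
      rw [neg_mulVec, Pi.add_apply, Pi.neg_apply, B0]
      simp
    have hs2 : 0 < s 2 := ((hED s).mp hs).2
    have hnorm : ∀ x : Fin 3 → ℝ, x 0 = 0 → 0 < x 2 → x = x 2 • ![0, x 1 / x 2, 1] := by
      intro x hx0 hx2
      ext i
      fin_cases i
      · simp [hx0]
      · simp; field_simp
      · simp
    have hord : ∀ S : Set (Fin 3 → ℝ), Convex ℝ S → {r : ℝ | ![0, r, 1] ∈ S}.OrdConnected := by
      intro S hS
      rw [← convex_iff_ordConnected]
      intro x hx y hy a b ha hb hab
      have := hS hx hy ha hb hab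
      simp only [Set.mem_ofPred_eq]
      convert this using 1
      ext i
      fin_cases i
      · simp
      · simp
      · simp [hab]
    have hNr : ∀ r : ℝ, (-B) *ᵥ ![0, r, 1] = (-n) • ![0, m / n * r + t / n, 1] := by
      intro r
      ext i
      rw [neg_mulVec, Pi.neg_apply]
      have hn0 := hn.ne
      fin_cases i
      · have := B0 ![0, r, 1]; simp at this ⊢; exact this
      · have := B1 ![0, r, 1]; simp at this ⊢; rw [this]; field_simp
      · have := B2 ![0, r, 1]; simp at this ⊢; exact this
    have hfin := ch_interval {r | ![0, r, 1] ∈ D} {r | ![0, r, 1] ∈ interior D} (m / n) (t / n)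
      (div_pos_of_neg_of_neg hm hn) (fun r hr => (interior_subset : interior D ⊆ D) hr) (hord D hDconv)
      (hord _ hDconv.interior) (by
        intro r
        simp only [Set.mem_ofPred_eq]
        rw [← hEN, hNr, hEsm _ (by linarith)]) (by
        intro r hr heq
        have h1 := hNr r
        rw [heq] at h1
        apply h.free _ ((memD _).mp hr).1 n
        rw [neg_mulVec, neg_smul, neg_inj] at h1
        exact h1)
      (s 1 / s 2) (by
        rw [hnorm s hs0 hs2, hEsm _ hs2] at hs
        exact hs)
      (q 1 / q 2) (by
        have : q ∈ D := (memD q).mpr ⟨hqC, hq2⟩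
        rw [hnorm q hq0 hq2, hDsm _ hq2] at this
        exact this)
    apply hqI
    have h1 : q ∈ interior D := by
      rw [hnorm q hq0 hq2, hEsm _ hq2]
      exact hfin
    exact ((hED q).mp h1).1
  · push Not at hemp
    obtain ⟨c, hc⟩ := h.strict (chLin 1 0 0) (chLin_ne _ _ _ (by norm_num))
      (fun u _ _ => hemp u) q hqC (B *ᵥ q) ((h.inv q).mpr hqC)
      (by rw [chLin_apply, hq0]; ring) (by rw [chLin_apply, B0, hq0]; ring)
    exact h.free q hqC c hc

/-- The cone over a subset of the projective plane. -/
def chCone (Ω : Set RP2) : Set (Fin 3 → ℝ) :=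
  {u | ∃ h : u ≠ 0, Projectivization.mk ℝ u h ∈ Ω}

theorem ch_isOpen_iff (U : Set RP2) :
    IsOpen U ↔ IsOpen {v : {v : Fin 3 → ℝ // v ≠ 0} | Projectivization.mk ℝ v.1 v.2 ∈ U} :=
  isOpen_coinduced

theorem ch_isOpen_subtype (S : Set (Fin 3 → ℝ)) (hS : IsOpen S) :
    IsOpen {v : {v : Fin 3 → ℝ // v ≠ 0} | v.1 ∈ S} :=
  hS.preimage continuous_subtype_val

theorem ch_rep (v : Fin 3 → ℝ) (hv : v ≠ 0) :
    ∃ c : ℝ, c ≠ 0 ∧ (Projectivization.mk ℝ v hv).rep = c • v := by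
  obtain ⟨a, ha⟩ := Projectivization.exists_smul_eq_mk_rep ℝ v hv
  exact ⟨a, a.ne_zero, ha.symm⟩

theorem ch_cone_smul (Ω : Set RP2) (c : ℝ) (hc : c ≠ 0) (u : Fin 3 → ℝ) :
    c • u ∈ chCone Ω ↔ u ∈ chCone Ω := by
  have key : ∀ (hu : u ≠ 0) (hcu : c • u ≠ 0),
      Projectivization.mk ℝ (c • u) hcu = Projectivization.mk ℝ u hu := by
    intro hu hcu
    rw [Projectivization.mk_eq_mk_iff']
    exact ⟨c, rfl⟩
  constructor
  · rintro ⟨h, h2⟩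
    have hu : u ≠ 0 := by rintro rfl; simp at h
    exact ⟨hu, by rwa [key hu h] at h2⟩
  · rintro ⟨h, h2⟩
    exact ⟨smul_ne_zero hc h, by rwa [key h]⟩

theorem ch_cone_interior (Ω : Set RP2) (u : Fin 3 → ℝ) (hu : u ≠ 0) :
    u ∈ interior (chCone Ω) ↔ Projectivization.mk ℝ u hu ∈ interior Ω := by
  have hsm : ∀ c : ℝ, c ≠ 0 → ∀ u, c • u ∈ interior (chCone Ω) ↔ u ∈ interior (chCone Ω) :=
    fun c hc => ch_interior_smul _ c hc (ch_cone_smul Ω c hc)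
  constructor
  · intro h
    have hopen : IsOpen {x : RP2 | x.rep ∈ interior (chCone Ω)} := by
      rw [ch_isOpen_iff]
      convert ch_isOpen_subtype _ (isOpen_interior (s := chCone Ω)) using 1
      ext v
      obtain ⟨c, hc, hv⟩ := ch_rep v.1 v.2
      simp only [Set.mem_ofPred_eq, hv, hsm c hc]
    refine mem_interior.mpr ⟨_, ?_, hopen, ?_⟩
    · intro x hx
      obtain ⟨h1, h2⟩ := interior_subset (s := chCone Ω) hx
      rwa [Projectivization.mk_rep] at h2
    · obtain ⟨c, hc, hv⟩ := ch_rep u hu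
      simp only [Set.mem_ofPred_eq, hv, hsm c hc]
      exact h
  · intro h
    have h1 := (ch_isOpen_iff _).mp (isOpen_interior (s := Ω))
    have h0 : IsOpen {v : Fin 3 → ℝ | v ≠ 0} := isOpen_ne
    have h2 := h0.isOpenMap_subtype_val _ h1
    refine mem_interior.mpr ⟨_, ?_, h2, ?_⟩
    · rintro _ ⟨v, hv, rfl⟩
      exact ⟨v.2, interior_subset hv⟩
    · exact ⟨⟨u, hu⟩, h, rfl⟩

theorem ch_sign_open (f g : (Fin 3 → ℝ) →ₗ[ℝ] ℝ) :
    IsOpen {x : RP2 | 0 < f x.rep * g x.rep} := by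
  rw [ch_isOpen_iff]
  have hf := f.continuous_of_finiteDimensional
  have hg := g.continuous_of_finiteDimensional
  convert ch_isOpen_subtype {v | 0 < f v * g v}
    (isOpen_lt continuous_const (hf.mul hg)) using 1
  ext v
  obtain ⟨c, hc, hv⟩ := ch_rep v.1 v.2
  simp only [Set.mem_ofPred_eq, hv, map_smul, smul_eq_mul]
  have : c * f v * (c * g v) = (c * c) * (f v * g v) := by ring
  rw [this]
  exact mul_pos_iff_of_pos_left (mul_self_pos.mpr hc)

theorem ch_sign (f g : (Fin 3 → ℝ) →ₗ[ℝ] ℝ) (S : Set RP2) (hS : IsPreconnected S)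
    (hne : ∀ x ∈ S, f x.rep * g x.rep ≠ 0) (x y : RP2) (hx : x ∈ S) (hy : y ∈ S)
    (hpos : 0 < f x.rep * g x.rep) : 0 < f y.rep * g y.rep := by
  by_contra hcon
  have h2 : 0 < (-f) y.rep * g y.rep := by
    have := lt_of_le_of_ne (not_lt.mp hcon) (hne y hy)
    simp only [LinearMap.neg_apply]; linarith
  obtain ⟨z, _, hz1, hz2⟩ := hS _ _ (ch_sign_open f g) (ch_sign_open (-f) g) (by
    intro z hz
    rcases lt_or_gt_of_ne (hne z hz) with h | h
    · right; simp only [Set.mem_ofPred_eq, LinearMap.neg_apply]; linarith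
    · left; exact h) ⟨x, hx, hpos⟩ ⟨y, hy, h2⟩
  simp only [Set.mem_ofPred_eq, LinearMap.neg_apply] at hz1 hz2
  linarith

theorem ch_sign_mk (f g : (Fin 3 → ℝ) →ₗ[ℝ] ℝ) (v : Fin 3 → ℝ) (hv : v ≠ 0) :
    0 < f (Projectivization.mk ℝ v hv).rep * g (Projectivization.mk ℝ v hv).rep ↔
      0 < f v * g v := by
  obtain ⟨c, hc, hv⟩ := ch_rep v hv
  simp only [hv, map_smul, smul_eq_mul]
  have : c * f v * (c * g v) = (c * c) * (f v * g v) := by ring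
  rw [this]
  exact mul_pos_iff_of_pos_left (mul_self_pos.mpr hc)

theorem ch_ker (k : (Fin 3 → ℝ) →ₗ[ℝ] ℝ) (hk : k ≠ 0) :
    Module.finrank ℝ (LinearMap.ker k) = 2 := by
  have h1 := LinearMap.finrank_range_add_finrank_ker k
  rw [LinearMap.range_eq_top.mpr (LinearMap.surjective hk)] at h1
  simp at h1
  omega

theorem ch_le (k : (Fin 3 → ℝ) →ₗ[ℝ] ℝ) (x : RP2) :
    x.submodule ≤ LinearMap.ker k ↔ k x.rep = 0 := by
  rw [Projectivization.submodule_eq, Submodule.span_singleton_le_iff_mem, LinearMap.mem_ker]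

theorem ch_le_mk (k : (Fin 3 → ℝ) →ₗ[ℝ] ℝ) (v : Fin 3 → ℝ) (hv : v ≠ 0) :
    (Projectivization.mk ℝ v hv).submodule ≤ LinearMap.ker k ↔ k v = 0 := by
  rw [Projectivization.submodule_mk, Submodule.span_singleton_le_iff_mem, LinearMap.mem_ker]

theorem ch_rep_mem (Ω : Set RP2) (x : RP2) : x.rep ∈ chCone Ω ↔ x ∈ Ω := by
  constructor
  · rintro ⟨h, h2⟩; rwa [Projectivization.mk_rep] at h2
  · intro h; exact ⟨x.rep_nonzero, by rwa [Projectivization.mk_rep]⟩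

theorem ch_good (A : Matrix (Fin 3) (Fin 3) ℝ)
    (hinj : Function.Injective (Matrix.toLin' (A ^ 1)))
    (Ω : Set RP2)
    (hconv : ProperlyConvex Ω)
    (hbd : StrictlyConvexBoundary Ω)
    (hpres : Projectivization.map (Matrix.toLin' (A ^ 1)) hinj '' Ω = Ω)
    (hfree : ∀ x ∈ Ω, Projectivization.map (Matrix.toLin' (A ^ 1)) hinj x ≠ x)
    (γ : ℝ → RP2) (hγ : Continuous γ) (hγr : Set.range γ = Ω \ interior Ω) :
    ChGood A (chCone Ω) := by
  have hAu : ∀ u, Matrix.toLin' (A ^ 1) u = A *ᵥ u := by intro u; simp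
  have hA0 : ∀ u, u ≠ 0 → A *ᵥ u ≠ 0 := by
    intro u hu h0
    apply hu
    apply hinj
    rw [hAu, h0, map_zero]
  have hmap : ∀ u (hu : u ≠ 0), Projectivization.map (Matrix.toLin' (A ^ 1)) hinj
      (Projectivization.mk ℝ u hu) = Projectivization.mk ℝ (A *ᵥ u) (hA0 u hu) := by
    intro u hu
    rw [Projectivization.map_mk]
    simp only [hAu]
  have hbdmem : ∀ u ∈ chCone Ω \ interior (chCone Ω), ∃ h : u ≠ 0,
      Projectivization.mk ℝ u h ∈ Ω \ interior Ω := by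
    rintro u ⟨⟨h, h1⟩, h2⟩
    refine ⟨h, h1, ?_⟩
    rwa [ch_cone_interior Ω u h] at h2
  have hbdmem' : ∀ x ∈ Ω \ interior Ω, x.rep ∈ chCone Ω \ interior (chCone Ω) := by
    intro x hx
    refine ⟨(ch_rep_mem Ω x).mpr hx.1, ?_⟩
    rw [ch_cone_interior Ω _ x.rep_nonzero, Projectivization.mk_rep]
    exact hx.2
  refine ⟨?_, ?_, ?_, ?_, ?_, ?_, ?_, ?_, ?_, ?_⟩
  · exact fun c hc u => ch_cone_smul Ω c hc u
  · rintro ⟨h, _⟩; exact h rfl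
  · intro u
    constructor
    · rintro ⟨h, h2⟩
      have hu : u ≠ 0 := by rintro rfl; simp at h
      refine ⟨hu, ?_⟩
      rw [← hpres, ← hmap u hu] at h2
      obtain ⟨y, hy, hy2⟩ := h2
      rwa [← Projectivization.map_injective _ hinj hy2]
    · rintro ⟨h, h2⟩
      refine ⟨hA0 u h, ?_⟩
      rw [← hpres, ← hmap u h]
      exact ⟨_, h2, rfl⟩
  · rintro u ⟨h, h2⟩ c hc
    apply hfree _ h2
    rw [hmap, Projectivization.mk_eq_mk_iff']
    exact ⟨c, hc.symm⟩
  · rintro k f g hk hfg u ⟨hu, huΩ⟩ w ⟨hw, hwΩ⟩ hku hkw hpos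
    rw [← ch_sign_mk f g u hu] at hpos
    rw [← ch_sign_mk f g w hw]
    refine ch_sign f g _ (hconv _ (ch_ker k hk)).1 ?_ _ _ ⟨huΩ, (ch_le_mk k u hu).mpr hku⟩
      ⟨hwΩ, (ch_le_mk k w hw).mpr hkw⟩ hpos
    rintro x ⟨hx, hkx⟩
    exact hfg _ ((ch_rep_mem Ω x).mpr hx) ((ch_le k x).mp hkx)
  · intro k hk
    obtain ⟨p, _, hp, _, _, hpΩ, _⟩ := (hconv _ (ch_ker k hk)).2
    exact ⟨p.rep, p.rep_nonzero, (ch_le k p).mp hp, fun h => hpΩ ((ch_rep_mem Ω p).mp h)⟩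
  · rintro k hk hint u ⟨hu, huΩ⟩ w ⟨hw, hwΩ⟩ hku hkw
    have := hbd _ (ch_ker k hk) _ ?_ (hconv _ (ch_ker k hk)).1
      ⟨hwΩ, (ch_le_mk k w hw).mpr hkw⟩ ⟨huΩ, (ch_le_mk k u hu).mpr hku⟩
    · rw [Projectivization.mk_eq_mk_iff'] at this
      obtain ⟨c, hc⟩ := this
      exact ⟨c, hc.symm⟩
    · rintro x ⟨hx, hkx⟩
      refine ⟨⟨hx, ?_⟩, hkx⟩
      have := hint x.rep ((ch_rep_mem Ω x).mpr hx) ((ch_le k x).mp hkx)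
      rwa [ch_cone_interior Ω _ x.rep_nonzero, Projectivization.mk_rep] at this
  · have : γ 0 ∈ Ω \ interior Ω := hγr ▸ Set.mem_range_self 0
    exact ⟨_, (hbdmem' _ this).1⟩
  · have : γ 0 ∈ Ω \ interior Ω := hγr ▸ Set.mem_range_self 0
    exact ⟨_, hbdmem' _ this⟩
  · intro f g hfg u hu w hw hpos
    obtain ⟨hu0, huΩ⟩ := hbdmem u hu
    obtain ⟨hw0, hwΩ⟩ := hbdmem w hw
    rw [← ch_sign_mk f g u hu0] at hpos
    rw [← ch_sign_mk f g w hw0]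
    refine ch_sign f g (Ω \ interior Ω) ?_ ?_ _ _ huΩ hwΩ hpos
    · rw [← hγr]; exact isPreconnected_range hγ
    · intro x hx
      exact hfg _ (hbdmem' x hx)

/-- Let `A ∈ SL(3,ℝ)` generate an infinite cyclic group preserving a
properly convex subset `Ω ⊂ ℝP²` homeomorphic to a disc minus a boundary point, acting
freely on Ω and preserving orientation (encoded: acting on the boundary curve of Ω by an
orientation-preserving reparametrization), with ∂Ω strictly convex. Then all eigenvalues
of A are real and, after replacing A by -A if necessary, positive; hence A is conjugate
over ℝ to an upper triangular matrix with positive diagonal entries. -/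
theorem cusp_holonomy_real_positive_eigenvalues
    (A : Matrix.SpecialLinearGroup (Fin 3) ℝ)
    (hinj : ∀ k : ℕ,
      Function.Injective (Matrix.toLin' ((A : Matrix (Fin 3) (Fin 3) ℝ) ^ k)))
    (Ω : Set RP2)
    (hconv : ProperlyConvex Ω)
    (htop : Nonempty (↥Ω ≃ₜ ↥discMinusPoint))
    (hbd : StrictlyConvexBoundary Ω)
    (hpres :
      Projectivization.map (Matrix.toLin' ((A : Matrix (Fin 3) (Fin 3) ℝ) ^ 1)) (hinj 1) '' Ω = Ω)
    (hinfinite : ∀ k : ℕ, 0 < k → (A : Matrix (Fin 3) (Fin 3) ℝ) ^ k ≠ 1)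
    (hfree : ∀ x ∈ Ω, ∀ k : ℕ, 0 < k →
      Projectivization.map (Matrix.toLin' ((A : Matrix (Fin 3) (Fin 3) ℝ) ^ k)) (hinj k) x ≠ x)
    (horient : ∃ γ : ℝ → RP2, Continuous γ ∧ Function.Injective γ ∧
      Set.range γ = Ω \ interior Ω ∧ ∃ τ : ℝ → ℝ, StrictMono τ ∧ ∀ s : ℝ,
        Projectivization.map (Matrix.toLin' ((A : Matrix (Fin 3) (Fin 3) ℝ) ^ 1)) (hinj 1) (γ s)
          = γ (τ s)) :
    (∀ μ : ℂ,
      (((A : Matrix (Fin 3) (Fin 3) ℝ).charpoly).map (algebraMap ℝ ℂ)).IsRoot μ → μ.im = 0) ∧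
    ∃ ε : ℝ, (ε = 1 ∨ ε = -1) ∧
      ∃ P : Matrix (Fin 3) (Fin 3) ℝ, IsUnit P ∧
        (P * (ε • (A : Matrix (Fin 3) (Fin 3) ℝ)) * P⁻¹).BlockTriangular id ∧
        ∀ i : Fin 3, 0 < (P * (ε • (A : Matrix (Fin 3) (Fin 3) ℝ)) * P⁻¹) i i := by
  obtain ⟨γ, hγ, -, hγr, -⟩ := horient
  have hgood := ch_good (A : Matrix (Fin 3) (Fin 3) ℝ) (hinj 1) Ω hconv hbd hpres
    (fun x hx => hfree x hx 1 one_pos) γ hγ hγr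
  rcases ch_reduce (A : Matrix (Fin 3) (Fin 3) ℝ) A.det_coe with
    ⟨P, l, m, n, r, s, t, hP, hl, hm, hn, hAP⟩ | ⟨P, l, a, b, c, d, hP, hl, hd, hAP⟩ |
    ⟨P, l, m, n, t, hP, hl, hm, hn, hAP⟩
  · have hu : IsUnit P.det := isUnit_iff_ne_zero.mpr hP
    have hT : (!![l, r, s; 0, m, t; 0, 0, n] : Matrix (Fin 3) (Fin 3) ℝ).BlockTriangular id := by
      intro i j hij
      fin_cases i <;> fin_cases j <;> simp at hij ⊢
    have hconj : P⁻¹ * (A : Matrix (Fin 3) (Fin 3) ℝ) * P⁻¹⁻¹ =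
        !![l, r, s; 0, m, t; 0, 0, n] := by
      rw [nonsing_inv_nonsing_inv _ hu, Matrix.mul_assoc, hAP, ← Matrix.mul_assoc,
        nonsing_inv_mul _ hu, Matrix.one_mul]
    constructor
    · intro μ hμ
      have hA : (A : Matrix (Fin 3) (Fin 3) ℝ) = P * !![l, r, s; 0, m, t; 0, 0, n] * P⁻¹ := by
        rw [← hAP, Matrix.mul_assoc, mul_nonsing_inv _ hu, Matrix.mul_one]
      have hch : (A : Matrix (Fin 3) (Fin 3) ℝ).charpoly =
          (!![l, r, s; 0, m, t; 0, 0, n] : Matrix (Fin 3) (Fin 3) ℝ).charpoly := by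
        rw [hA, Matrix.charpoly_mul_comm, ← Matrix.mul_assoc, nonsing_inv_mul _ hu,
          Matrix.one_mul]
      rw [hch, charpoly_of_upperTriangular _ hT, Fin.prod_univ_three] at hμ
      simp [Polynomial.IsRoot, sub_eq_zero] at hμ
      rcases hμ with (h | h) | h <;> rw [h] <;> simp
    · refine ⟨1, Or.inl rfl, P⁻¹, ?_, ?_, ?_⟩
      · rw [Matrix.isUnit_iff_isUnit_det]
        exact isUnit_nonsing_inv_det _ hu
      · rw [one_smul, hconj]; exact hT
      · rw [one_smul, hconj]
        intro i
        fin_cases i <;> simp [hl, hm, hn]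
  · exact ((hgood.transport hP hAP).not_elliptic hl hd).elim
  · exact ((hgood.transport hP hAP).not_reversing hl hm hn).elim
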